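/- arXiv:2103.02271 — 3 statements merged into one kernel-verified Lean document; each statement's English description precedes it below -/
import Mathlib

section
/- The local iterates of the distributed proximal gradient algorithm achieve consensus: for every agent i ∈ {1,…,m}, the series ∑_{k=2}^∞ ‖x_{i,k} − x̄_k‖ converges, and consequently lim_{k→∞} ‖x_{i,k} − x̄_k‖ = 0, where x̄_k = (1/m)∑_{j=1}^m x_{j,k}. -/
open scoped RealInnerProductSpace
open Filter

/-- Variational inequality satisfied by a proximal point of a convex function. -/
theorem inner_le_of_isMin_prox {E : Type*} [NormedAddCommGroup E] [InnerProductSpace ℝ E]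
    {h : E → ℝ} (hconv : ConvexOn ℝ Set.univ h) {c : ℝ} (hc : 0 < c) {w p : E}
    (hp : ∀ z, h p + c * ‖p - w‖ ^ 2 ≤ h z + c * ‖z - w‖ ^ 2) (z : E) :
    2 * c * ⟪w - p, z - p⟫ ≤ h z - h p := by
  have key : ∀ t : ℝ, 0 < t → t ≤ 1 →
      0 ≤ (h z - h p + 2 * c * ⟪p - w, z - p⟫) + c * ‖z - p‖ ^ 2 * t := by
    intro t ht ht1
    have h1 := hp ((1 - t) • p + t • z)
    have h2 := hconv.2 (Set.mem_univ p) (Set.mem_univ z) (sub_nonneg.2 ht1) ht.le (by ring)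
    have h3 : (1 - t) • p + t • z - w = (p - w) + t • (z - p) := by module
    rw [h3, norm_add_sq_real, inner_smul_right, norm_smul, Real.norm_eq_abs, abs_of_pos ht] at h1
    simp only [smul_eq_mul] at h2
    refine (mul_nonneg_iff_of_pos_left ht).1 ?_
    linarith
  have hneg : ⟪w - p, z - p⟫ = -⟪p - w, z - p⟫ := by
    rw [← inner_neg_left, neg_sub]
  rw [hneg]
  by_contra hcon
  set a := h z - h p + 2 * c * ⟪p - w, z - p⟫
  have ha0 : a < 0 := by linarith
  set b := c * ‖z - p‖ ^ 2
  have hb0 : 0 ≤ b := by positivity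
  have hba : 0 < b - a := by linarith
  have h1 := key (-a / (b - a)) (div_pos (by linarith) hba)
    ((div_le_one hba).2 (by linarith))
  have h2 : a + b * (-a / (b - a)) = -(a ^ 2 / (b - a)) := by
    field_simp
    ring
  have h3 : 0 < a ^ 2 / (b - a) := div_pos (sq_pos_of_neg ha0) hba
  linarith

/-- The proximal map of a convex function is nonexpansive. -/
theorem norm_prox_sub_prox_le {E : Type*} [NormedAddCommGroup E] [InnerProductSpace ℝ E]
    {h : E → ℝ} (hconv : ConvexOn ℝ Set.univ h) {c : ℝ} (hc : 0 < c) {prox : E → E}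
    (hprox : ∀ w z, h (prox w) + c * ‖prox w - w‖ ^ 2 ≤ h z + c * ‖z - w‖ ^ 2) (w w' : E) :
    ‖prox w - prox w'‖ ≤ ‖w - w'‖ := by
  have h1 := inner_le_of_isMin_prox hconv hc (hprox w) (prox w')
  have h2 := inner_le_of_isMin_prox hconv hc (hprox w') (prox w)
  have h3 : ⟪w - prox w, prox w' - prox w⟫ + ⟪w' - prox w', prox w - prox w'⟫
      = ‖prox w - prox w'‖ ^ 2 - ⟪w - w', prox w - prox w'⟫ := by
    rw [← real_inner_self_eq_norm_sq, ← neg_sub (prox w) (prox w'), inner_neg_right,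
      neg_add_eq_sub, ← inner_sub_left, ← inner_sub_left]
    congr 1
    abel
  have h4 : ⟪w - prox w, prox w' - prox w⟫ + ⟪w' - prox w', prox w - prox w'⟫ ≤ 0 := by
    refine nonpos_of_mul_nonpos_right (a := 2 * c) ?_ (by positivity)
    linarith
  have h5 := real_inner_le_norm (w - w') (prox w - prox w')
  by_contra! hlt
  have h6 : 0 < ‖prox w - prox w'‖ := (norm_nonneg _).trans_lt hlt
  nlinarith

/-- Averaging with weights whose columns sum to one does not increase the total norm. -/
theorem sum_norm_sum_smul_le {ι E : Type*} [Fintype ι] [NormedAddCommGroup E] [NormedSpace ℝ E]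
    {a : ι → ι → ℝ} (ha : ∀ i j, 0 ≤ a i j) (hcol : ∀ j, ∑ i, a i j = 1) (q : ι → E) :
    ∑ i, ‖∑ j, a i j • q j‖ ≤ ∑ j, ‖q j‖ :=
  calc ∑ i, ‖∑ j, a i j • q j‖ ≤ ∑ i, ∑ j, a i j * ‖q j‖ := by
        refine Finset.sum_le_sum fun i _ => (norm_sum_le _ _).trans_eq ?_
        simp only [norm_smul, Real.norm_eq_abs, abs_of_nonneg (ha i _)]
    _ = ∑ j, ‖q j‖ := by
        rw [Finset.sum_comm]
        simp only [← Finset.sum_mul, hcol, one_mul]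

/-- Two linear combinations with coefficients near a common value are near each other. -/
theorem norm_sum_smul_sub_sum_smul_le {ι E : Type*} [Fintype ι] [NormedAddCommGroup E]
    [NormedSpace ℝ E] {a b : ι → ℝ} {c ε : ℝ} (ha : ∀ j, |a j - c| ≤ ε)
    (hb : ∀ j, |b j - c| ≤ ε) (q : ι → E) :
    ‖∑ j, a j • q j - ∑ j, b j • q j‖ ≤ 2 * ε * ∑ j, ‖q j‖ := by
  rw [← Finset.sum_sub_distrib, Finset.mul_sum]
  refine norm_sum_le_of_le _ fun j _ => ?_
  rw [← sub_smul, norm_smul, Real.norm_eq_abs]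
  refine mul_le_mul_of_nonneg_right ?_ (norm_nonneg _)
  have h1 := abs_sub_le (a j) c (b j)
  rw [abs_sub_comm c] at h1
  linarith [ha j, hb j]

/-- A point at distance at most `r` from all members of a family is at distance at most `r`
from their mean. -/
theorem norm_sub_mean_le {m : ℕ} (hm : 1 ≤ m) {E : Type*} [NormedAddCommGroup E]
    [NormedSpace ℝ E] {x : Fin m → E} {y : E} {r : ℝ} (hr : ∀ j, ‖y - x j‖ ≤ r) :
    ‖y - (m : ℝ)⁻¹ • ∑ j, x j‖ ≤ r := by
  have hm0 : (m : ℝ) ≠ 0 := by positivity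
  have h1 : y - (m : ℝ)⁻¹ • ∑ j, x j = (m : ℝ)⁻¹ • ∑ j, (y - x j) := by
    rw [Finset.sum_sub_distrib, Finset.sum_const, Finset.card_univ, Fintype.card_fin,
      ← Nat.cast_smul_eq_nsmul ℝ, smul_sub, smul_smul, inv_mul_cancel₀ hm0, one_smul]
  have h2 : ‖∑ j, (y - x j)‖ ≤ m * r := by
    refine (norm_sum_le_of_le _ fun j _ => hr j).trans_eq ?_
    simp
  rw [h1, norm_smul, norm_inv, Real.norm_natCast]
  exact (mul_le_mul_of_nonneg_left h2 (by positivity)).trans_eq (inv_mul_cancel_left₀ hm0 r)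

theorem stmt_10
    (n m : ℕ) (hn : 0 < n) (hm : 1 ≤ m)
    (g : Fin m → EuclideanSpace ℝ (Fin n) → ℝ)
    (G : Fin m → EuclideanSpace ℝ (Fin n) → EuclideanSpace ℝ (Fin n))
    (L Gg Gh α : ℝ) (hL : 0 < L)
    (hgrad : ∀ i x, HasGradientAt (g i) (G i x) x)
    (hLip : ∀ i x y, ‖G i x - G i y‖ ≤ L * ‖x - y‖)
    (hGg : ∀ i x, ‖G i x‖ ≤ Gg)
    (h : EuclideanSpace ℝ (Fin n) → ℝ)
    (hconv : ConvexOn ℝ Set.univ h)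
    (hGh : 0 < Gh)
    (hsub : ∀ x z : EuclideanSpace ℝ (Fin n), (∀ u, h x + ⟪z, u - x⟫ ≤ h u) → ‖z‖ ≤ Gh)
    (hα0 : 0 < α) (hα1 : α < 1 / L)
    (prox : EuclideanSpace ℝ (Fin n) → EuclideanSpace ℝ (Fin n))
    (hprox : ∀ w z, h (prox w) + (1 / (2 * α)) * ‖prox w - w‖ ^ 2
      ≤ h z + (1 / (2 * α)) * ‖z - w‖ ^ 2)
    (hproxuniq : ∀ w z, (∀ u, h z + (1 / (2 * α)) * ‖z - w‖ ^ 2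
      ≤ h u + (1 / (2 * α)) * ‖u - w‖ ^ 2) → z = prox w)
    (lam : ℕ → Fin m → Fin m → ℝ) (Γ γ : ℝ) (hΓ : 0 < Γ) (hγ0 : 0 < γ) (hγ1 : γ < 1)
    (hlamnn : ∀ k, 2 ≤ k → ∀ i j, 0 ≤ lam k i j)
    (hrow : ∀ k, 2 ≤ k → ∀ i, ∑ j, lam k i j = 1)
    (hcol : ∀ k, 2 ≤ k → ∀ j, ∑ i, lam k i j = 1)
    (hmix : ∀ k, 2 ≤ k → ∀ i j, |lam k i j - 1 / (m : ℝ)| ≤ Γ * γ ^ k)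
    (x q v : ℕ → Fin m → EuclideanSpace ℝ (Fin n))
    (hq : ∀ k, 1 ≤ k → ∀ i, q (k + 1) i = x k i - α • G i (x k i))
    (hv : ∀ k, 1 ≤ k → ∀ i, v (k + 1) i = ∑ j, lam (k + 1) i j • q (k + 1) j)
    (hx : ∀ k, 1 ≤ k → ∀ i, x (k + 1) i = prox (v (k + 1) i))
    (xbar : ℕ → EuclideanSpace ℝ (Fin n))
    (hxbar : ∀ k, xbar k = (m : ℝ)⁻¹ • ∑ i, x k i)
    :
    (∀ i, Summable (fun k : ℕ => ‖x (k + 2) i - xbar (k + 2)‖)) ∧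
    (∀ i, Tendsto (fun k : ℕ => ‖x k i - xbar k‖) atTop (nhds 0)) := by
  have hc : 0 < 1 / (2 * α) := by positivity
  have hne := norm_prox_sub_prox_le hconv hc hprox
  have hqsum : ∀ k, 1 ≤ k → ∑ j, ‖q (k + 1) j‖ ≤ ∑ j, ‖x k j‖ + m * (α * Gg) := by
    intro k hk
    calc ∑ j, ‖q (k + 1) j‖ ≤ ∑ j, (‖x k j‖ + α * Gg) := by
          refine Finset.sum_le_sum fun j _ => ?_
          rw [hq k hk j]
          refine (norm_sub_le _ _).trans ?_
          rw [norm_smul, Real.norm_eq_abs, abs_of_pos hα0]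
          gcongr
          exact hGg j _
      _ = _ := by simp [Finset.sum_add_distrib]
  have hxsucc : ∀ k, 1 ≤ k →
      ∑ i, ‖x (k + 1) i‖ ≤ ∑ i, ‖x k i‖ + m * (α * Gg + ‖prox 0‖) := by
    intro k hk
    have h1 : ∑ i, ‖x (k + 1) i‖ ≤ ∑ i, (‖v (k + 1) i‖ + ‖prox 0‖) := by
      refine Finset.sum_le_sum fun i _ => ?_
      have h2 := hne (v (k + 1) i) 0
      rw [sub_zero] at h2
      rw [hx k hk i]
      linarith [norm_sub_norm_le (prox (v (k + 1) i)) (prox 0)]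
    have h3 : ∑ i, ‖v (k + 1) i‖ ≤ ∑ j, ‖q (k + 1) j‖ := by
      simp only [hv k hk]
      exact sum_norm_sum_smul_le (hlamnn _ (by omega)) (hcol _ (by omega)) _
    have h4 : ∑ i, (‖v (k + 1) i‖ + ‖prox 0‖) = ∑ i, ‖v (k + 1) i‖ + m * ‖prox 0‖ := by
      simp [Finset.sum_add_distrib]
    linarith [hqsum k hk]
  set D := (m : ℝ) * (α * Gg + ‖prox 0‖)
  have hgrowth : ∀ k : ℕ, ∑ i, ‖x (k + 1) i‖ ≤ ∑ i, ‖x 1 i‖ + k * D := by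
    intro k
    induction k with
    | zero => simp
    | succ k ih =>
      push_cast
      linarith [hxsucc (k + 1) (by omega)]
  set C := ∑ i, ‖x 1 i‖ + m * (α * Gg)
  have hbound : ∀ i (k : ℕ),
      ‖x (k + 2) i - xbar (k + 2)‖ ≤ 2 * (Γ * γ ^ (k + 2)) * (C + k * D) := by
    intro i k
    rw [hxbar]
    refine norm_sub_mean_le hm fun j => ?_
    rw [hx (k + 1) (by omega) i, hx (k + 1) (by omega) j]
    refine (hne _ _).trans ?_
    rw [hv (k + 1) (by omega) i, hv (k + 1) (by omega) j]
    refine (norm_sum_smul_sub_sum_smul_le (hmix (k + 1 + 1) (by omega) i)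
      (hmix (k + 1 + 1) (by omega) j) _).trans ?_
    refine mul_le_mul_of_nonneg_left ?_ (by positivity)
    linarith [hqsum (k + 1) (by omega), hgrowth k]
  have hsummable : Summable fun k : ℕ => 2 * (Γ * γ ^ (k + 2)) * (C + k * D) := by
    have hγ : ‖γ‖ < 1 := by rwa [Real.norm_eq_abs, abs_of_pos hγ0]
    have h0 := (summable_geometric_of_norm_lt_one hγ).mul_left (2 * Γ * γ ^ 2 * C)
    have h1 := (summable_pow_mul_geometric_of_norm_lt_one 1 hγ).mul_left (2 * Γ * γ ^ 2 * D)
    refine (h0.add h1).congr fun k => ?_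
    ring
  have hmain : ∀ i, Summable (fun k : ℕ => ‖x (k + 2) i - xbar (k + 2)‖) := fun i =>
    hsummable.of_nonneg_of_le (fun _ => norm_nonneg _) (hbound i)
  exact ⟨hmain, fun i => (tendsto_add_atTop_iff_nat 2).1 (hmain i).tendsto_atTop_zero⟩
end

section
/- For the distributed proximal gradient algorithm, the series ∑_{k=1}^∞ ‖x̄_{k+1} − x̄_k‖² converges, where x̄_k = (1/m)∑_{i=1}^m x_{i,k}. -/
open scoped RealInnerProductSpace
open Filter

section Aux

variable {E : Type*} [NormedAddCommGroup E] [InnerProductSpace ℝ E]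

/-- Optimality condition of the proximal step: `α⁻¹ • (w - p)` is a subgradient of `h` at `p`. -/
lemma subgradient_of_prox {h : E → ℝ} (hconv : ConvexOn ℝ Set.univ h) {α : ℝ} (hα : 0 < α)
    {p w : E}
    (hp : ∀ z, h p + (1 / (2 * α)) * ‖p - w‖ ^ 2 ≤ h z + (1 / (2 * α)) * ‖z - w‖ ^ 2) (u : E) :
    h p + ⟪α⁻¹ • (w - p), u - p⟫ ≤ h u := by
  have key : ∀ t : ℝ, 0 < t → t ≤ 1 →
      h p + ⟪α⁻¹ • (w - p), u - p⟫ - h u ≤ t * (1 / (2 * α) * ‖u - p‖ ^ 2) := by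
    intro t ht ht1
    have hc := hconv.2 (Set.mem_univ p) (Set.mem_univ u) (sub_nonneg.2 ht1) ht.le (by ring)
    have hm := hp ((1 - t) • p + t • u)
    have hz : (1 - t) • p + t • u - w = (p - w) + t • (u - p) := by module
    have hi : ⟪α⁻¹ • (w - p), u - p⟫ = -(α⁻¹ * ⟪p - w, u - p⟫) := by
      rw [← neg_sub p w, smul_neg, inner_neg_left, real_inner_smul_left]
    rw [hz, norm_add_sq_real, real_inner_smul_right, norm_smul, mul_pow, Real.norm_eq_abs,
      sq_abs] at hm
    simp only [smul_eq_mul] at hc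
    rw [hi]
    have hα' : 1 / (2 * α) = α⁻¹ / 2 := by field_simp
    rw [hα'] at hm ⊢
    refine le_of_mul_le_mul_left ?_ ht
    linear_combination hm + hc
  by_contra! hlt
  set A := h p + ⟪α⁻¹ • (w - p), u - p⟫ - h u with hA
  have hApos : 0 < A := by linarith
  have hlim : Tendsto (fun t : ℝ => t * (1 / (2 * α) * ‖u - p‖ ^ 2)) (nhdsWithin 0 (Set.Ioi 0))
      (nhds 0) := by
    have : Continuous (fun t : ℝ => t * (1 / (2 * α) * ‖u - p‖ ^ 2)) := by fun_prop
    simpa using (this.tendsto 0).mono_left nhdsWithin_le_nhds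
  have : A ≤ 0 := by
    refine ge_of_tendsto hlim ?_
    filter_upwards [Ioc_mem_nhdsGT (zero_lt_one (α := ℝ))] with t ht using key t ht.1 ht.2
  linarith

/-- The proximal step is nonexpansive. -/
lemma norm_prox_sub_prox_le_s14 {h : E → ℝ} (hconv : ConvexOn ℝ Set.univ h) {α : ℝ} (hα : 0 < α)
    {p w p' w' : E}
    (hp : ∀ z, h p + (1 / (2 * α)) * ‖p - w‖ ^ 2 ≤ h z + (1 / (2 * α)) * ‖z - w‖ ^ 2)
    (hp' : ∀ z, h p' + (1 / (2 * α)) * ‖p' - w'‖ ^ 2 ≤ h z + (1 / (2 * α)) * ‖z - w'‖ ^ 2) :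
    ‖p - p'‖ ≤ ‖w - w'‖ := by
  have h1 := subgradient_of_prox hconv hα hp p'
  have h2 := subgradient_of_prox hconv hα hp' p
  rw [real_inner_smul_left] at h1 h2
  have h3 : α⁻¹ * (⟪w - p, p' - p⟫ + ⟪w' - p', p - p'⟫) ≤ 0 := by linarith
  have h4 : ⟪w - p, p' - p⟫ + ⟪w' - p', p - p'⟫ ≤ 0 :=
    nonpos_of_mul_nonpos_right h3 (inv_pos.2 hα)
  have h5 : ⟪w - p, p' - p⟫ + ⟪w' - p', p - p'⟫ = ‖p - p'‖ ^ 2 - ⟪w - w', p - p'⟫ := by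
    rw [← real_inner_self_eq_norm_sq]
    simp only [inner_sub_left, inner_sub_right]
    ring
  have h6 := real_inner_le_norm (w - w') (p - p')
  by_contra! hlt
  nlinarith [norm_nonneg (w - w')]

/-- Quadratic upper bound for a function with Lipschitz gradient. -/
lemma le_quadratic_of_lipschitz_gradient [CompleteSpace E] {g : E → ℝ} {G : E → E} {L : ℝ}
    (hgrad : ∀ x, HasGradientAt g (G x) x) (hLip : ∀ x y, ‖G x - G y‖ ≤ L * ‖x - y‖) (x d : E) :
    g (x + d) ≤ g x + ⟪G x, d⟫ + L / 2 * ‖d‖ ^ 2 := by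
  have hder : ∀ t : ℝ, HasDerivAt (fun t : ℝ => g (x + t • d)) ⟪G (x + t • d), d⟫ t := by
    intro t
    have hl : HasDerivAt (fun t : ℝ => x + t • d) d t := by
      simpa using ((hasDerivAt_id t).smul_const d).const_add x
    exact ((hgrad (x + t • d)).hasFDerivAt.comp_hasDerivAt t hl).congr_deriv (by simp)
  have hderB : ∀ t : ℝ, HasDerivAt (fun t : ℝ => g x + t * ⟪G x, d⟫ + L / 2 * ‖d‖ ^ 2 * t ^ 2)
      (⟪G x, d⟫ + L * ‖d‖ ^ 2 * t) t := by
    intro t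
    have h1 := ((hasDerivAt_id t).mul_const ⟪G x, d⟫).const_add (g x)
    have h2 := (hasDerivAt_pow 2 t).const_mul (L / 2 * ‖d‖ ^ 2)
    refine (h1.add h2).congr_deriv ?_
    simp
    ring
  have := image_le_of_deriv_right_le_deriv_boundary (a := (0 : ℝ)) (b := 1)
    (fun t _ => (hder t).continuousAt.continuousWithinAt)
    (fun t _ => (hder t).hasDerivWithinAt) (by simp)
    (fun t _ => (hderB t).continuousAt.continuousWithinAt)
    (fun t _ => (hderB t).hasDerivWithinAt)
    (fun t ht => by
      have h1 : ⟪G (x + t • d) - G x, d⟫ ≤ L * ‖t • d‖ * ‖d‖ := by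
        refine (real_inner_le_norm _ _).trans ?_
        gcongr
        simpa using hLip (x + t • d) x
      rw [inner_sub_left, norm_smul, Real.norm_eq_abs, abs_of_nonneg ht.1] at h1
      linarith)
    (Set.right_mem_Icc.2 zero_le_one)
  simpa using this

/-- Perturbed monotone descent: decrements are summable if the errors are and the values are
bounded below. -/
lemma summable_of_descent {F D e : ℕ → ℝ} {B : ℝ} (hD : ∀ k, 0 ≤ D k) (he : Summable e)
    (he0 : ∀ k, 0 ≤ e k) (hB : ∀ k, B ≤ F k) (hdesc : ∀ k, F (k + 1) + D k ≤ F k + e k) :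
    Summable D := by
  refine summable_of_sum_range_le (c := F 0 - B + ∑' k, e k) hD fun N => ?_
  have hsum : F N + ∑ k ∈ Finset.range N, D k ≤ F 0 + ∑ k ∈ Finset.range N, e k := by
    induction N with
    | zero => simp
    | succ N ih =>
      rw [Finset.sum_range_succ, Finset.sum_range_succ]
      linarith [hdesc N]
  linarith [hB N, he.sum_le_tsum (Finset.range N) fun k _ => he0 k]

lemma norm_mean_le {m : ℕ} (hm : 1 ≤ m) {c : ℝ} {y : Fin m → E} (hy : ∀ i, ‖y i‖ ≤ c) :
    ‖(m : ℝ)⁻¹ • ∑ i, y i‖ ≤ c := by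
  have hm0 : (0 : ℝ) < m := by exact_mod_cast hm
  rw [norm_smul, norm_inv, Real.norm_natCast, inv_mul_le_iff₀ hm0]
  simpa using norm_sum_le_of_le Finset.univ fun i _ => hy i

lemma mean_const {m : ℕ} (hm : 1 ≤ m) (y : E) : (m : ℝ)⁻¹ • ∑ _i : Fin m, y = y := by
  have hm0 : (m : ℝ) ≠ 0 := by exact_mod_cast (by omega : m ≠ 0)
  rw [Finset.sum_const, Finset.card_univ, Fintype.card_fin, ← Nat.cast_smul_eq_nsmul ℝ, smul_smul,
    inv_mul_cancel₀ hm0, one_smul]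

/-- Two averages of the same points differ by at most the weight discrepancy times the total
size of the points. -/
lemma norm_weighted_sum_sub_le {m : ℕ} {a b : Fin m → ℝ} {c δ : ℝ} (ha : ∀ j, |a j - c| ≤ δ)
    (hb : ∀ j, |b j - c| ≤ δ) (y : Fin m → E) :
    ‖∑ j, a j • y j - ∑ j, b j • y j‖ ≤ 2 * δ * ∑ j, ‖y j‖ := by
  rw [← Finset.sum_sub_distrib, Finset.mul_sum]
  refine norm_sum_le_of_le _ fun j _ => ?_
  rw [← sub_smul, norm_smul, Real.norm_eq_abs]
  gcongr
  have := abs_sub_le (a j) c (b j)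
  rw [abs_sub_comm c] at this
  linarith [ha j, hb j]

/-- One averaged proximal gradient step decreases the objective up to consensus errors. -/
lemma averaged_prox_grad_descent [CompleteSpace E] {m : ℕ} (hm : 1 ≤ m) {g : Fin m → E → ℝ}
    {G : Fin m → E → E} {L Gg Gh α ε ε' : ℝ} (hL : 0 < L) (hα : 0 < α)
    (hgrad : ∀ i x, HasGradientAt (g i) (G i x) x)
    (hLip : ∀ i x y, ‖G i x - G i y‖ ≤ L * ‖x - y‖) (hGg : ∀ i x, ‖G i x‖ ≤ Gg)
    {h : E → ℝ} (hconv : ConvexOn ℝ Set.univ h) {x x' z : Fin m → E} {a a' : E}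
    (ha' : a' = (m : ℝ)⁻¹ • ∑ i, x' i)
    (hsub : ∀ i u, h (x' i) + ⟪z i, u - x' i⟫ ≤ h u) (hz : ∀ i, ‖z i‖ ≤ Gh)
    (hstep : a' = a - α • (m : ℝ)⁻¹ • ∑ i, G i (x i) - α • (m : ℝ)⁻¹ • ∑ i, z i)
    (hε : ∀ i, ‖x i - a‖ ≤ ε) (hε' : ∀ i, ‖x' i - a'‖ ≤ ε') :
    (m : ℝ)⁻¹ * ∑ i, g i a' + h a' + (1 / α - L / 2) * ‖a' - a‖ ^ 2
      ≤ (m : ℝ)⁻¹ * ∑ i, g i a + h a + (L * ε * (α * (Gg + Gh)) + Gh * ε') := by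
  have hm0 : (0 : ℝ) < m := by exact_mod_cast hm
  set d := a' - a with hd
  set Gm := (m : ℝ)⁻¹ • ∑ i, G i (x i) with hGm
  set zm := (m : ℝ)⁻¹ • ∑ i, z i with hzm
  have hdeq : d = -(α • (Gm + zm)) := by rw [hd, hstep]; module
  have hdn : ‖d‖ ≤ α * (Gg + Gh) := by
    rw [hdeq, norm_neg, norm_smul, Real.norm_eq_abs, abs_of_pos hα]
    gcongr
    exact (norm_add_le _ _).trans
      (add_le_add (norm_mean_le hm fun i => hGg i _) (norm_mean_le hm hz))
  have hzmeq : zm = -(α⁻¹ • d) - Gm := by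
    rw [hdeq, smul_neg, smul_smul, inv_mul_cancel₀ hα.ne', one_smul]; module
  have hinner : ⟪zm, d⟫ = -(1 / α * ‖d‖ ^ 2) - ⟪Gm, d⟫ := by
    rw [hzmeq, inner_sub_left, inner_neg_left, real_inner_smul_left, real_inner_self_eq_norm_sq,
      one_div]
  have hmean : ∀ c : ℝ, (m : ℝ)⁻¹ * ∑ _i : Fin m, c = c := fun c => by
    simpa using mean_const hm c
  have hg : (m : ℝ)⁻¹ * ∑ i, g i a' ≤
      (m : ℝ)⁻¹ * ∑ i, g i a + ⟪Gm, d⟫ + L / 2 * ‖d‖ ^ 2 + L * ε * (α * (Gg + Gh)) := by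
    have hi : ∀ i, g i a' ≤
        g i a + ⟪G i (x i), d⟫ + (L / 2 * ‖d‖ ^ 2 + L * ε * (α * (Gg + Gh))) := by
      intro i
      have h1 := le_quadratic_of_lipschitz_gradient (hgrad i) (hLip i) a d
      rw [show a + d = a' by rw [hd]; abel] at h1
      have h2 : ⟪G i a - G i (x i), d⟫ ≤ L * ε * (α * (Gg + Gh)) := by
        refine (real_inner_le_norm _ _).trans ?_
        have h3 : ‖G i a - G i (x i)‖ ≤ L * ε := by
          refine (hLip i _ _).trans ?_
          rw [norm_sub_rev]
          exact mul_le_mul_of_nonneg_left (hε i) hL.le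
        exact mul_le_mul h3 hdn (norm_nonneg _) ((norm_nonneg _).trans h3)
      rw [inner_sub_left] at h2
      linarith
    have hs := mul_le_mul_of_nonneg_left (Finset.sum_le_sum fun i (_ : i ∈ Finset.univ) => hi i)
      (inv_pos.2 hm0).le
    rw [Finset.sum_add_distrib, Finset.sum_add_distrib, mul_add, mul_add, hmean, ← sum_inner,
      ← real_inner_smul_left, ← hGm] at hs
    linarith
  have hh : h a' ≤ h a + ⟪zm, d⟫ + Gh * ε' := by
    have hJ : h a' ≤ (m : ℝ)⁻¹ * ∑ i, h (x' i) := by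
      have := hconv.map_sum_le (t := Finset.univ) (w := fun _ : Fin m => (m : ℝ)⁻¹) (p := x')
        (fun _ _ => (inv_pos.2 hm0).le) (by simp [hm0.ne']) (fun _ _ => Set.mem_univ _)
      simpa only [← Finset.smul_sum, ← ha', smul_eq_mul, ← Finset.mul_sum] using this
    have hi : ∀ i, h (x' i) ≤ h a + ⟪z i, d⟫ + Gh * ε' := by
      intro i
      have h1 := hsub i a
      have h2 : ⟪z i, x' i - a'⟫ ≤ Gh * ε' :=
        (real_inner_le_norm _ _).trans
          (mul_le_mul (hz i) (hε' i) (norm_nonneg _) ((norm_nonneg _).trans (hz i)))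
      have h3 : a - x' i = -d - (x' i - a') := by rw [hd]; abel
      rw [h3, inner_sub_right, inner_neg_right] at h1
      linarith
    have hs := mul_le_mul_of_nonneg_left (Finset.sum_le_sum fun i (_ : i ∈ Finset.univ) => hi i)
      (inv_pos.2 hm0).le
    rw [Finset.sum_add_distrib, Finset.sum_add_distrib, mul_add, mul_add, hmean, hmean,
      ← sum_inner, ← real_inner_smul_left, ← hzm] at hs
    linarith
  linarith

lemma summable_geometric_mul_affine {γ : ℝ} (hγ0 : 0 < γ) (hγ1 : γ < 1) (A B C : ℝ) :
    Summable fun k : ℕ => A * γ ^ (k + 2) * (B + k * C) := by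
  have hn : ‖γ‖ < 1 := by rwa [Real.norm_eq_abs, abs_of_pos hγ0]
  have h1 := (summable_geometric_of_norm_lt_one hn).mul_left (A * γ ^ 2 * B)
  have h2 := (summable_pow_mul_geometric_of_norm_lt_one 1 hn).mul_left (A * γ ^ 2 * C)
  refine (h1.add h2).congr fun k => ?_
  ring

end Aux

theorem stmt_14
    (n m : ℕ) (hn : 0 < n) (hm : 1 ≤ m)
    (g : Fin m → EuclideanSpace ℝ (Fin n) → ℝ)
    (G : Fin m → EuclideanSpace ℝ (Fin n) → EuclideanSpace ℝ (Fin n))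
    (L Gg Gh α : ℝ) (hL : 0 < L)
    (hgrad : ∀ i x, HasGradientAt (g i) (G i x) x)
    (hLip : ∀ i x y, ‖G i x - G i y‖ ≤ L * ‖x - y‖)
    (hGg : ∀ i x, ‖G i x‖ ≤ Gg)
    (h : EuclideanSpace ℝ (Fin n) → ℝ)
    (hconv : ConvexOn ℝ Set.univ h)
    (hGh : 0 < Gh)
    (hsub : ∀ x z : EuclideanSpace ℝ (Fin n), (∀ u, h x + ⟪z, u - x⟫ ≤ h u) → ‖z‖ ≤ Gh)
    (hα0 : 0 < α) (hα1 : α < 1 / L)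
    (prox : EuclideanSpace ℝ (Fin n) → EuclideanSpace ℝ (Fin n))
    (hprox : ∀ w z, h (prox w) + (1 / (2 * α)) * ‖prox w - w‖ ^ 2
      ≤ h z + (1 / (2 * α)) * ‖z - w‖ ^ 2)
    (hproxuniq : ∀ w z, (∀ u, h z + (1 / (2 * α)) * ‖z - w‖ ^ 2
      ≤ h u + (1 / (2 * α)) * ‖u - w‖ ^ 2) → z = prox w)
    (lam : ℕ → Fin m → Fin m → ℝ) (Γ γ : ℝ) (hΓ : 0 < Γ) (hγ0 : 0 < γ) (hγ1 : γ < 1)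
    (hlamnn : ∀ k, 2 ≤ k → ∀ i j, 0 ≤ lam k i j)
    (hrow : ∀ k, 2 ≤ k → ∀ i, ∑ j, lam k i j = 1)
    (hcol : ∀ k, 2 ≤ k → ∀ j, ∑ i, lam k i j = 1)
    (hmix : ∀ k, 2 ≤ k → ∀ i j, |lam k i j - 1 / (m : ℝ)| ≤ Γ * γ ^ k)
    (x q v : ℕ → Fin m → EuclideanSpace ℝ (Fin n))
    (hq : ∀ k, 1 ≤ k → ∀ i, q (k + 1) i = x k i - α • G i (x k i))
    (hv : ∀ k, 1 ≤ k → ∀ i, v (k + 1) i = ∑ j, lam (k + 1) i j • q (k + 1) j)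
    (hx : ∀ k, 1 ≤ k → ∀ i, x (k + 1) i = prox (v (k + 1) i))
    (xbar : ℕ → EuclideanSpace ℝ (Fin n))
    (hxbar : ∀ k, xbar k = (m : ℝ)⁻¹ • ∑ i, x k i)
    (gavg f : EuclideanSpace ℝ (Fin n) → ℝ)
    (hgavg : ∀ y, gavg y = (m : ℝ)⁻¹ * ∑ i, g i y)
    (hf : ∀ y, f y = gavg y + h y)
    (xstar : EuclideanSpace ℝ (Fin n))
    (hxstar : ∀ y, f xstar ≤ f y)
    :
    Summable (fun k : ℕ => ‖xbar (k + 2) - xbar (k + 1)‖ ^ 2) := by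
  have hp : ∀ k i z, h (x (k + 2) i) + (1 / (2 * α)) * ‖x (k + 2) i - v (k + 2) i‖ ^ 2
      ≤ h z + (1 / (2 * α)) * ‖z - v (k + 2) i‖ ^ 2 := by
    intro k i z
    rw [hx (k + 1) (by omega) i]
    exact hprox _ _
  set z : ℕ → Fin m → EuclideanSpace ℝ (Fin n) :=
    fun k i => α⁻¹ • (v (k + 2) i - x (k + 2) i) with hz
  have hzsub : ∀ k i u, h (x (k + 2) i) + ⟪z k i, u - x (k + 2) i⟫ ≤ h u :=
    fun k i => subgradient_of_prox hconv hα0 (hp k i)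
  have hzle : ∀ k i, ‖z k i‖ ≤ Gh := fun k i => hsub _ _ (hzsub k i)
  have hxz : ∀ k i, x (k + 2) i = v (k + 2) i - α • z k i := by
    intro k i
    simp only [hz, smul_smul, mul_inv_cancel₀ hα0.ne', one_smul, sub_sub_cancel]
  have hGg0 : 0 ≤ Gg := (norm_nonneg _).trans (hGg ⟨0, hm⟩ 0)
  -- The total size of the gradient steps grows at most linearly.
  set C : ℝ := m * (α * (Gg + Gh)) with hC
  have hC0 : 0 ≤ C := by positivity
  have hgrow : ∀ k : ℕ, ∑ j, ‖q (k + 2) j‖ ≤ ∑ j, ‖q 2 j‖ + k * C := by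
    intro k
    induction k with
    | zero => simp
    | succ k ih =>
      have hvsum : ∑ i, ‖v (k + 2) i‖ ≤ ∑ j, ‖q (k + 2) j‖ := by
        calc ∑ i, ‖v (k + 2) i‖ ≤ ∑ i, ∑ j, lam (k + 2) i j * ‖q (k + 2) j‖ := by
              refine Finset.sum_le_sum fun i _ => ?_
              rw [hv (k + 1) (by omega) i]
              refine norm_sum_le_of_le _ fun j _ => ?_
              rw [norm_smul, Real.norm_eq_abs, abs_of_nonneg (hlamnn _ (by omega) i j)]
          _ = ∑ j, ‖q (k + 2) j‖ := by
              rw [Finset.sum_comm]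
              refine Finset.sum_congr rfl fun j _ => ?_
              rw [← Finset.sum_mul, hcol _ (by omega), one_mul]
      have hqle : ∀ i, ‖q (k + 1 + 2) i‖ ≤ ‖v (k + 2) i‖ + α * (Gg + Gh) := by
        intro i
        rw [hq (k + 2) (by omega) i]
        have h1 := norm_sub_le (x (k + 2) i) (α • G i (x (k + 2) i))
        have h2 := norm_sub_le (v (k + 2) i) (α • z k i)
        rw [← hxz] at h2
        rw [norm_smul, Real.norm_eq_abs, abs_of_pos hα0] at h1 h2
        have h3 := mul_le_mul_of_nonneg_left (hGg i (x (k + 2) i)) hα0.le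
        have h4 := mul_le_mul_of_nonneg_left (hzle k i) hα0.le
        linarith
      have hs := Finset.sum_le_sum fun i (_ : i ∈ Finset.univ) => hqle i
      rw [Finset.sum_add_distrib, Finset.sum_const, Finset.card_univ, Fintype.card_fin,
        nsmul_eq_mul, ← hC] at hs
      push_cast
      linarith
  -- The agents reach consensus at a summable rate.
  set ε : ℕ → ℝ := fun k => 2 * Γ * γ ^ (k + 2) * (∑ j, ‖q 2 j‖ + k * C) with hε
  have hε0 : ∀ k, 0 ≤ ε k := fun k => by positivity
  have hεsum : Summable ε := summable_geometric_mul_affine hγ0 hγ1 _ _ _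
  have hcons : ∀ k i, ‖x (k + 2) i - xbar (k + 2)‖ ≤ ε k := by
    intro k i
    have hpair : ∀ l, ‖x (k + 2) i - x (k + 2) l‖ ≤ ε k := by
      intro l
      refine (norm_prox_sub_prox_le_s14 hconv hα0 (hp k i) (hp k l)).trans ?_
      rw [hv (k + 1) (by omega) i, hv (k + 1) (by omega) l]
      refine (norm_weighted_sum_sub_le (hmix (k + 2) (by omega) i) (hmix (k + 2) (by omega) l)
        (q (k + 2))).trans ?_
      rw [← mul_assoc]
      exact mul_le_mul_of_nonneg_left (hgrow k) (by positivity)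
    have := norm_mean_le hm hpair
    rwa [Finset.sum_sub_distrib, smul_sub, mean_const hm, ← hxbar] at this
  have hstep : ∀ k, xbar (k + 1 + 2) = xbar (k + 2)
      - α • (m : ℝ)⁻¹ • ∑ i, G i (x (k + 2) i) - α • (m : ℝ)⁻¹ • ∑ i, z (k + 1) i := by
    intro k
    have hvq : ∑ i, v (k + 1 + 2) i = ∑ j, q (k + 1 + 2) j := by
      rw [Finset.sum_congr rfl fun i _ => hv (k + 2) (by omega) i, Finset.sum_comm]
      refine Finset.sum_congr rfl fun j _ => ?_
      rw [← Finset.sum_smul, hcol _ (by omega), one_smul]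
    rw [hxbar, hxbar, Finset.sum_congr rfl fun i _ => hxz (k + 1) i, Finset.sum_sub_distrib, hvq,
      Finset.sum_congr rfl fun i _ => hq (k + 2) (by omega) i, Finset.sum_sub_distrib,
      ← Finset.smul_sum, ← Finset.smul_sum]
    module
  have hc : 0 < 1 / α - L / 2 := by
    have : L < 1 / α := (lt_one_div hα0 hL).1 hα1
    linarith
  have hfeq : ∀ y, f y = (m : ℝ)⁻¹ * ∑ i, g i y + h y := fun y => by rw [hf, hgavg]
  have hsum : Summable fun k => (1 / α - L / 2) * ‖xbar (k + 1 + 2) - xbar (k + 2)‖ ^ 2 := by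
    refine summable_of_descent (F := fun k => f (xbar (k + 2)))
      (e := fun k => L * ε k * (α * (Gg + Gh)) + Gh * ε (k + 1)) (B := f xstar)
      (fun k => by positivity) ?_ (fun k => ?_) (fun k => hxstar _) (fun k => ?_)
    · exact ((hεsum.mul_left L).mul_right _).add
        (((summable_nat_add_iff 1).2 hεsum).mul_left Gh)
    · have := hε0 k
      have := hε0 (k + 1)
      positivity
    · simp only [hfeq]
      exact averaged_prox_grad_descent hm hL hα0 hgrad hLip hGg hconv (hxbar _)
        (hzsub (k + 1)) (hzle (k + 1)) (hstep k) (hcons k) (hcons (k + 1))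
  exact (summable_nat_add_iff 1).1 ((summable_mul_left_iff hc.ne').1 hsum)
end

section
/- For the distributed proximal gradient algorithm, the successive averaged iterates become asymptotically stationary: lim_{k→∞} ‖x̄_{k+1} − x̄_k‖ = 0, where x̄_k = (1/m)∑_{i=1}^m x_{i,k}. -/
open scoped RealInnerProductSpace
open Filter

section ProximalGradient

variable {E : Type*} [NormedAddCommGroup E] [InnerProductSpace ℝ E]

/-- Descent lemma: a function whose gradient is `L`-Lipschitz lies below its quadratic model. -/
theorem descent_of_lipschitz_gradient [CompleteSpace E] {φ : E → ℝ} {D : E → E} {L : ℝ}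
    (hD : ∀ x, HasGradientAt φ (D x) x) (hL : ∀ x y, ‖D x - D y‖ ≤ L * ‖x - y‖) (x y : E) :
    φ y ≤ φ x + ⟪D x, y - x⟫ + L / 2 * ‖y - x‖ ^ 2 := by
  set d := y - x with hd
  let ψ : ℝ → ℝ := fun t => φ (x + t • d) - t * ⟪D x, d⟫ - L / 2 * t ^ 2 * ‖d‖ ^ 2
  have hψ : ∀ t, HasDerivAt ψ (⟪D (x + t • d), d⟫ - ⟪D x, d⟫ - L * t * ‖d‖ ^ 2) t := by
    intro t
    have hline : HasDerivAt (fun t : ℝ => x + t • d) d t := by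
      simpa using ((hasDerivAt_id t).smul_const d).const_add x
    have hcomp : HasDerivAt (fun t : ℝ => φ (x + t • d)) ⟪D (x + t • d), d⟫ t := by
      have hc := (hD (x + t • d)).hasFDerivAt.comp_hasDerivAt t hline
      rwa [InnerProductSpace.toDual_apply_apply] at hc
    have hlin : HasDerivAt (fun t : ℝ => t * ⟪D x, d⟫) ⟪D x, d⟫ t := by
      simpa using (hasDerivAt_id t).mul_const ⟪D x, d⟫
    have hquad : HasDerivAt (fun t : ℝ => L / 2 * t ^ 2 * ‖d‖ ^ 2) (L * t * ‖d‖ ^ 2) t := by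
      refine (((hasDerivAt_pow 2 t).const_mul (L / 2)).mul_const (‖d‖ ^ 2)).congr_deriv ?_
      push_cast
      ring
    exact (hcomp.sub hlin).sub hquad
  have hanti : AntitoneOn ψ (Set.Ici 0) := by
    refine antitoneOn_of_deriv_nonpos (convex_Ici 0)
      (fun t _ => (hψ t).continuousAt.continuousWithinAt)
      (fun t _ => (hψ t).differentiableAt.differentiableWithinAt) ?_
    intro t ht
    rw [interior_Ici] at ht
    have ht0 : (0 : ℝ) < t := ht
    rw [(hψ t).deriv, ← inner_sub_left]
    have h1 := real_inner_le_norm (D (x + t • d) - D x) d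
    have h2 := hL (x + t • d) x
    rw [add_sub_cancel_left, norm_smul, Real.norm_of_nonneg ht0.le] at h2
    nlinarith [mul_le_mul_of_nonneg_right h2 (norm_nonneg d)]
  have h01 := hanti (Set.mem_Ici.2 le_rfl) (Set.mem_Ici.2 zero_le_one) zero_le_one
  have hxy : x + d = y := by rw [hd]; abel
  simp only [ψ, one_smul, zero_smul, add_zero, hxy] at h01
  linarith

/-- Optimality condition for the proximal point: `α⁻¹ • (w - p)` is a subgradient at `p`. -/
theorem subgradient_of_isMin_prox {h : E → ℝ} (hconv : ConvexOn ℝ Set.univ h) {α : ℝ}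
    (hα : 0 < α) {w p : E}
    (hp : ∀ z, h p + (1 / (2 * α)) * ‖p - w‖ ^ 2 ≤ h z + (1 / (2 * α)) * ‖z - w‖ ^ 2) (u : E) :
    h p + ⟪α⁻¹ • (w - p), u - p⟫ ≤ h u := by
  have key : ∀ t ∈ Set.Ioc (0 : ℝ) 1,
      h p + ⟪α⁻¹ • (w - p), u - p⟫ ≤ h u + t * ((1 / (2 * α)) * ‖u - p‖ ^ 2) := by
    rintro t ⟨ht0, ht1⟩
    have hc := hconv.2 (Set.mem_univ p) (Set.mem_univ u) (sub_nonneg.2 ht1) ht0.le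
      (sub_add_cancel 1 t)
    have hm := hp ((1 - t) • p + t • u)
    have he : (1 - t) • p + t • u - w = (p - w) + t • (u - p) := by module
    rw [he, norm_add_sq_real, norm_smul, Real.norm_of_nonneg ht0.le, inner_smul_right,
      ← neg_sub w p, inner_neg_left, norm_neg] at hm
    simp only [smul_eq_mul] at hc
    rw [real_inner_smul_left]
    have hα' : (1 / (2 * α)) = α⁻¹ / 2 := by field_simp
    rw [hα'] at hm ⊢
    refine le_of_mul_le_mul_left ?_ ht0
    nlinarith
  have hlim : Tendsto (fun t : ℝ => h u + t * ((1 / (2 * α)) * ‖u - p‖ ^ 2))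
      (nhdsWithin 0 (Set.Ioi 0)) (nhds (h u)) := by
    have : Continuous (fun t : ℝ => h u + t * ((1 / (2 * α)) * ‖u - p‖ ^ 2)) := by fun_prop
    simpa using (this.tendsto 0).mono_left nhdsWithin_le_nhds
  refine ge_of_tendsto hlim ?_
  filter_upwards [Ioc_mem_nhdsGT (zero_lt_one' ℝ)] with t ht using key t ht

/-- Proximal points depend on the base point in a nonexpansive way. -/
theorem norm_prox_sub_prox_le_s15 {h : E → ℝ} {α : ℝ} (hα : 0 < α) {prox : E → E}
    (hp : ∀ w u, h (prox w) + ⟪α⁻¹ • (w - prox w), u - prox w⟫ ≤ h u) (w z : E) :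
    ‖prox w - prox z‖ ≤ ‖w - z‖ := by
  have h1 := hp w (prox z)
  have h2 := hp z (prox w)
  set p := prox w
  set r := prox z
  rw [real_inner_smul_left] at h1 h2
  have h3 : α⁻¹ * (⟪w - p, r - p⟫ + ⟪z - r, p - r⟫) ≤ 0 := by linarith
  have h4 : ⟪w - p, r - p⟫ + ⟪z - r, p - r⟫ ≤ 0 := nonpos_of_mul_nonpos_right h3 (inv_pos.2 hα)
  have h5 : ⟪w - p, r - p⟫ + ⟪z - r, p - r⟫ = ‖p - r‖ ^ 2 - ⟪w - z, p - r⟫ := by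
    rw [← real_inner_self_eq_norm_sq, ← neg_sub p r, inner_neg_right, ← sub_eq_neg_add,
      ← inner_sub_left, ← inner_sub_left]
    congr 1
    abel
  have h6 := real_inner_le_norm (w - z) (p - r)
  by_contra! hlt
  nlinarith [norm_nonneg (w - z)]

/-- One inexact proximal gradient step: if the base point `w` is within `ε` of the exact gradient
step from `y`, the objective decreases up to an error of order `ε ^ 2`. -/
theorem prox_step_decrease {φ h : E → ℝ} {L α ε : ℝ} (hα : 0 < α) (hαL : α < 1 / L) (hL : 0 < L)
    {w y p d : E} (hdesc : φ p ≤ φ y + ⟪d, p - y⟫ + L / 2 * ‖p - y‖ ^ 2)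
    (hp : ∀ z, h p + (1 / (2 * α)) * ‖p - w‖ ^ 2 ≤ h z + (1 / (2 * α)) * ‖z - w‖ ^ 2)
    (hw : ‖w - (y - α • d)‖ ≤ ε) :
    φ p + h p + (α⁻¹ - L) / 4 * ‖p - y‖ ^ 2 ≤
      φ y + h y + (α⁻¹ ^ 2 / (α⁻¹ - L)) * ε ^ 2 := by
  have hpos : 0 < α⁻¹ - L := by
    rw [sub_pos, lt_inv_comm₀ hL hα]
    simpa using hαL
  set r := w - (y - α • d) with hr
  set s := p - y with hs
  have e1 : p - w = s + (α • d - r) := by rw [hs, hr]; abel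
  have e2 : y - w = α • d - r := by rw [hr]; abel
  have hy := hp y
  have hα' : (1 / (2 * α)) = α⁻¹ / 2 := by field_simp
  have hαα : α⁻¹ * α = 1 := inv_mul_cancel₀ hα.ne'
  rw [e1, e2, norm_add_sq_real, inner_sub_right, inner_smul_right, real_inner_comm d s, hα'] at hy
  have hcs : α⁻¹ * ⟪s, r⟫ ≤ α⁻¹ * (‖s‖ * ε) :=
    mul_le_mul_of_nonneg_left ((real_inner_le_norm s r).trans
      (mul_le_mul_of_nonneg_left hw (norm_nonneg s))) (inv_pos.2 hα).le
  have hyoung : α⁻¹ * (‖s‖ * ε) ≤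
      (α⁻¹ - L) / 4 * ‖s‖ ^ 2 + (α⁻¹ ^ 2 / (α⁻¹ - L)) * ε ^ 2 := by
    have hsq : (α⁻¹ - L) / 4 * ‖s‖ ^ 2 + (α⁻¹ ^ 2 / (α⁻¹ - L)) * ε ^ 2 - α⁻¹ * (‖s‖ * ε) =
        ((α⁻¹ - L) / 2 * ‖s‖ - α⁻¹ * ε) ^ 2 / (α⁻¹ - L) := by
      generalize α⁻¹ = β at *
      generalize hc : β - L = c at *
      field_simp
      ring
    have : 0 ≤ ((α⁻¹ - L) / 2 * ‖s‖ - α⁻¹ * ε) ^ 2 / (α⁻¹ - L) := by positivity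
    linarith
  have hexp : α⁻¹ / 2 * (‖s‖ ^ 2 + 2 * (α * ⟪d, s⟫ - ⟪s, r⟫) + ‖α • d - r‖ ^ 2) =
      α⁻¹ / 2 * ‖s‖ ^ 2 + ⟪d, s⟫ - α⁻¹ * ⟪s, r⟫ + α⁻¹ / 2 * ‖α • d - r‖ ^ 2 := by
    linear_combination ⟪d, s⟫ * hαα
  rw [hexp] at hy
  linarith

end ProximalGradient

/-- A perturbed decrease along a sequence bounded below forces the decrements to vanish. -/
theorem tendsto_zero_of_perturbed_decrease {a b s : ℕ → ℝ} {c : ℝ} (hb : ∀ k, 0 ≤ b k)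
    (hs0 : ∀ k, 0 ≤ s k) (hs : Summable s) (ha : ∀ k, c ≤ a k)
    (hstep : ∀ k, a (k + 1) + b k ≤ a k + s k) : Tendsto b atTop (nhds 0) := by
  refine (summable_of_sum_range_le (c := a 0 - c + ∑' k, s k) hb fun N => ?_).tendsto_atTop_zero
  have hN : a N + ∑ k ∈ Finset.range N, b k ≤ a 0 + ∑ k ∈ Finset.range N, s k := by
    induction N with
    | zero => simp
    | succ N ih =>
      rw [Finset.sum_range_succ, Finset.sum_range_succ]
      linarith [hstep N]
  linarith [ha N, hs.sum_le_tsum (Finset.range N) fun k _ => hs0 k]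

/-- Squares of affine multiples of a geometric sequence are summable. -/
theorem summable_sq_affine_mul_geometric {γ : ℝ} (hγ0 : 0 < γ) (hγ1 : γ < 1) (a b : ℝ) :
    Summable fun k : ℕ => ((a + b * k) * γ ^ k) ^ 2 := by
  have hr : ‖γ ^ 2‖ < 1 := by
    rw [Real.norm_of_nonneg (by positivity)]
    nlinarith
  have h0 := (summable_pow_mul_geometric_of_norm_lt_one 0 hr).mul_left (a ^ 2)
  have h1 := (summable_pow_mul_geometric_of_norm_lt_one 1 hr).mul_left (2 * a * b)
  have h2 := (summable_pow_mul_geometric_of_norm_lt_one 2 hr).mul_left (b ^ 2)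
  refine ((h0.add h1).add h2).congr fun k => ?_
  ring

/-- The norm of an average is at most any common bound on the norms of the terms. -/
theorem norm_average_le {E : Type*} [NormedAddCommGroup E] [NormedSpace ℝ E] {m : ℕ} (hm : 1 ≤ m)
    {u : Fin m → E} {c : ℝ} (hu : ∀ i, ‖u i‖ ≤ c) : ‖(m : ℝ)⁻¹ • ∑ i, u i‖ ≤ c := by
  have hm0 : (0 : ℝ) < m := by exact_mod_cast hm
  have hsum : ‖∑ i, u i‖ ≤ m * c := by
    simpa using norm_sum_le_of_le Finset.univ fun i _ => hu i
  rw [norm_smul, Real.norm_of_nonneg (inv_pos.2 hm0).le]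
  exact (inv_mul_le_iff₀ hm0).2 hsum

/-- Subtracting a vector from an average amounts to subtracting it from every term. -/
theorem average_sub {E : Type*} [NormedAddCommGroup E] [NormedSpace ℝ E] {m : ℕ} (hm : 1 ≤ m)
    (u : Fin m → E) (y : E) :
    (m : ℝ)⁻¹ • ∑ i, u i - y = (m : ℝ)⁻¹ • ∑ i, (u i - y) := by
  have hm0 : (m : ℝ) ≠ 0 := by positivity
  rw [Finset.sum_sub_distrib, smul_sub, Finset.sum_const, Finset.card_univ, Fintype.card_fin,
    ← Nat.cast_smul_eq_nsmul ℝ, inv_smul_smul₀ hm0]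

/-- The average of differentiable functions has the average of the gradients as gradient. -/
theorem hasGradientAt_average {E : Type*} [NormedAddCommGroup E] [InnerProductSpace ℝ E]
    [CompleteSpace E] {m : ℕ} {g : Fin m → E → ℝ} {G : Fin m → E} {x : E}
    (hg : ∀ i, HasGradientAt (g i) (G i) x) :
    HasGradientAt (fun y => (m : ℝ)⁻¹ * ∑ i, g i y) ((m : ℝ)⁻¹ • ∑ i, G i) x := by
  rw [hasGradientAt_iff_hasFDerivAt, map_smul, map_sum]
  exact (HasFDerivAt.fun_sum fun i _ => (hg i).hasFDerivAt).const_mul _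

theorem stmt_15
    (n m : ℕ) (hn : 0 < n) (hm : 1 ≤ m)
    (g : Fin m → EuclideanSpace ℝ (Fin n) → ℝ)
    (G : Fin m → EuclideanSpace ℝ (Fin n) → EuclideanSpace ℝ (Fin n))
    (L Gg Gh α : ℝ) (hL : 0 < L)
    (hgrad : ∀ i x, HasGradientAt (g i) (G i x) x)
    (hLip : ∀ i x y, ‖G i x - G i y‖ ≤ L * ‖x - y‖)
    (hGg : ∀ i x, ‖G i x‖ ≤ Gg)
    (h : EuclideanSpace ℝ (Fin n) → ℝ)
    (hconv : ConvexOn ℝ Set.univ h)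
    (hGh : 0 < Gh)
    (hsub : ∀ x z : EuclideanSpace ℝ (Fin n), (∀ u, h x + ⟪z, u - x⟫ ≤ h u) → ‖z‖ ≤ Gh)
    (hα0 : 0 < α) (hα1 : α < 1 / L)
    (prox : EuclideanSpace ℝ (Fin n) → EuclideanSpace ℝ (Fin n))
    (hprox : ∀ w z, h (prox w) + (1 / (2 * α)) * ‖prox w - w‖ ^ 2
      ≤ h z + (1 / (2 * α)) * ‖z - w‖ ^ 2)
    (hproxuniq : ∀ w z, (∀ u, h z + (1 / (2 * α)) * ‖z - w‖ ^ 2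
      ≤ h u + (1 / (2 * α)) * ‖u - w‖ ^ 2) → z = prox w)
    (lam : ℕ → Fin m → Fin m → ℝ) (Γ γ : ℝ) (hΓ : 0 < Γ) (hγ0 : 0 < γ) (hγ1 : γ < 1)
    (hlamnn : ∀ k, 2 ≤ k → ∀ i j, 0 ≤ lam k i j)
    (hrow : ∀ k, 2 ≤ k → ∀ i, ∑ j, lam k i j = 1)
    (hcol : ∀ k, 2 ≤ k → ∀ j, ∑ i, lam k i j = 1)
    (hmix : ∀ k, 2 ≤ k → ∀ i j, |lam k i j - 1 / (m : ℝ)| ≤ Γ * γ ^ k)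
    (x q v : ℕ → Fin m → EuclideanSpace ℝ (Fin n))
    (hq : ∀ k, 1 ≤ k → ∀ i, q (k + 1) i = x k i - α • G i (x k i))
    (hv : ∀ k, 1 ≤ k → ∀ i, v (k + 1) i = ∑ j, lam (k + 1) i j • q (k + 1) j)
    (hx : ∀ k, 1 ≤ k → ∀ i, x (k + 1) i = prox (v (k + 1) i))
    (xbar : ℕ → EuclideanSpace ℝ (Fin n))
    (hxbar : ∀ k, xbar k = (m : ℝ)⁻¹ • ∑ i, x k i)
    (gavg f : EuclideanSpace ℝ (Fin n) → ℝ)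
    (hgavg : ∀ y, gavg y = (m : ℝ)⁻¹ * ∑ i, g i y)
    (hf : ∀ y, f y = gavg y + h y)
    (xstar : EuclideanSpace ℝ (Fin n))
    (hxstar : ∀ y, f xstar ≤ f y)
    :
    Tendsto (fun k : ℕ => ‖xbar (k + 1) - xbar k‖) atTop (nhds 0) := by
  have hm0 : (0 : ℝ) < m := by exact_mod_cast hm
  have hGg0 : 0 ≤ Gg := (norm_nonneg _).trans (hGg ⟨0, hm⟩ 0)
  have hsubgrad := fun w u => subgradient_of_isMin_prox hconv hα0 (hprox w) u
  have hprox_dist : ∀ w, ‖prox w - w‖ ≤ α * Gh := by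
    intro w
    have hz := hsub _ _ (hsubgrad w)
    rw [norm_smul, Real.norm_of_nonneg (inv_pos.2 hα0).le, inv_mul_le_iff₀ hα0] at hz
    rwa [norm_sub_rev]
  have hnonexp := norm_prox_sub_prox_le_s15 hα0 hsubgrad
  set B := ∑ i, ‖x 1 i‖
  set C := α * Gg + α * Gh with hC
  have hB0 : 0 ≤ B := Finset.sum_nonneg fun i _ => norm_nonneg _
  have hC0 : 0 ≤ C := by positivity
  have hqbound : ∀ k, 1 ≤ k → ∀ R, (∀ i, ‖x k i‖ ≤ R) → ∀ i, ‖q (k + 1) i‖ ≤ R + α * Gg := by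
    intro k hk R hR i
    rw [hq k hk i]
    refine (norm_sub_le _ _).trans (add_le_add (hR i) ?_)
    rw [norm_smul, Real.norm_of_nonneg hα0.le]
    exact mul_le_mul_of_nonneg_left (hGg _ _) hα0.le
  have hxbound : ∀ k, 1 ≤ k → ∀ i, ‖x k i‖ ≤ B + C * k := by
    intro k hk
    induction k, hk using Nat.le_induction with
    | base =>
      intro i
      have := Finset.single_le_sum (f := fun i => ‖x 1 i‖) (fun i _ => norm_nonneg _)
        (Finset.mem_univ i)
      have hB : ‖x 1 i‖ ≤ B := this
      push_cast
      linarith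
    | succ k hk ih =>
      intro i
      have hvb : ‖v (k + 1) i‖ ≤ B + C * k + α * Gg := by
        rw [hv k hk i]
        calc _ ≤ ∑ j, lam (k + 1) i j * (B + C * k + α * Gg) := by
              refine norm_sum_le_of_le _ fun j _ => ?_
              have hl := hlamnn (k + 1) (by omega) i j
              rw [norm_smul, Real.norm_of_nonneg hl]
              exact mul_le_mul_of_nonneg_left (hqbound k hk _ ih j) hl
          _ = _ := by rw [← Finset.sum_mul, hrow (k + 1) (by omega) i, one_mul]
      have hpv := hprox_dist (v (k + 1) i)
      have htri := norm_add_le (prox (v (k + 1) i) - v (k + 1) i) (v (k + 1) i)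
      rw [sub_add_cancel] at htri
      rw [hx k hk i]
      push_cast
      linarith
  let Y : ℕ → EuclideanSpace ℝ (Fin n) := fun k => prox ((m : ℝ)⁻¹ • ∑ i, q k i)
  let e : ℕ → ℝ := fun k => (m * Γ * (B + α * Gg) + m * Γ * C * k) * γ ^ k
  have hxY : ∀ k, 2 ≤ k → ∀ i, ‖x k i - Y k‖ ≤ e k := by
    intro k hk i
    obtain ⟨k, rfl⟩ : ∃ l, k = l + 1 := ⟨k - 1, by omega⟩
    have hk1 : 1 ≤ k := by omega
    rw [hx k hk1 i]
    refine (hnonexp _ _).trans ?_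
    rw [hv k hk1 i, Finset.smul_sum, ← Finset.sum_sub_distrib]
    calc _ ≤ ∑ _j : Fin m, Γ * γ ^ (k + 1) * (B + C * k + α * Gg) := by
          refine norm_sum_le_of_le _ fun j _ => ?_
          rw [← sub_smul, norm_smul, Real.norm_eq_abs, ← one_div]
          exact mul_le_mul (hmix _ hk i j) (hqbound k hk1 _ (hxbound k hk1) j) (norm_nonneg _)
            (by positivity)
      _ = (m * Γ * (B + α * Gg) + m * Γ * C * k) * γ ^ (k + 1) := by
          rw [Finset.sum_const, Finset.card_univ, Fintype.card_fin, nsmul_eq_mul]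
          ring
      _ ≤ e (k + 1) := by
          refine mul_le_mul_of_nonneg_right ?_ (by positivity)
          push_cast
          have : 0 ≤ m * Γ * C := by positivity
          linarith
  have hxbarY : ∀ k, 2 ≤ k → ‖xbar k - Y k‖ ≤ e k := by
    intro k hk
    rw [hxbar k, average_sub hm]
    exact norm_average_le hm (hxY k hk)
  have hesum : Summable fun k => e k ^ 2 := summable_sq_affine_mul_geometric hγ0 hγ1 _ _
  have hetend : Tendsto e atTop (nhds 0) := by
    have := hesum.tendsto_atTop_zero.sqrt
    simp only [Real.sqrt_sq_eq_abs, Real.sqrt_zero] at this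
    exact (tendsto_zero_iff_abs_tendsto_zero _).2 this
  let D : EuclideanSpace ℝ (Fin n) → EuclideanSpace ℝ (Fin n) := fun y => (m : ℝ)⁻¹ • ∑ i, G i y
  have hDgrad : ∀ y, HasGradientAt gavg (D y) y := by
    intro y
    rw [show gavg = fun y => (m : ℝ)⁻¹ * ∑ i, g i y from funext hgavg]
    exact hasGradientAt_average fun i => hgrad i y
  have hDlip : ∀ y z, ‖D y - D z‖ ≤ L * ‖y - z‖ := by
    intro y z
    simp only [D]
    rw [← smul_sub, ← Finset.sum_sub_distrib]
    exact norm_average_le hm fun i => hLip i y z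
  have hbase : ∀ k, 2 ≤ k →
      ‖(m : ℝ)⁻¹ • ∑ i, q (k + 1) i - (Y k - α • D (Y k))‖ ≤ (1 + α * L) * e k := by
    intro k hk
    have hrw : (m : ℝ)⁻¹ • ∑ i, q (k + 1) i - (Y k - α • D (Y k)) =
        (m : ℝ)⁻¹ • ∑ i, ((x k i - Y k) - α • (G i (x k i) - G i (Y k))) := by
      simp only [hq k (by omega), D, Finset.sum_sub_distrib, smul_sub, ← Finset.smul_sum]
      rw [Finset.sum_const, Finset.card_univ, Fintype.card_fin, ← Nat.cast_smul_eq_nsmul ℝ,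
        inv_smul_smul₀ hm0.ne', smul_comm α]
      abel
    rw [hrw]
    refine norm_average_le hm fun i => (norm_sub_le _ _).trans ?_
    rw [norm_smul, Real.norm_of_nonneg hα0.le]
    have h1 := hxY k hk i
    have h2 := mul_le_mul_of_nonneg_left
      ((hLip i (x k i) (Y k)).trans (mul_le_mul_of_nonneg_left h1 hL.le)) hα0.le
    linarith
  have hpos : 0 < α⁻¹ - L := by
    rw [sub_pos, lt_inv_comm₀ hL hα0]
    simpa using hα1
  have hdec : ∀ k, 2 ≤ k → f (Y (k + 1)) + (α⁻¹ - L) / 4 * ‖Y (k + 1) - Y k‖ ^ 2 ≤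
      f (Y k) + α⁻¹ ^ 2 / (α⁻¹ - L) * (1 + α * L) ^ 2 * e k ^ 2 := by
    intro k hk
    have := prox_step_decrease hα0 hα1 hL
      (descent_of_lipschitz_gradient hDgrad hDlip (Y k) (Y (k + 1))) (hprox _) (hbase k hk)
    rw [hf, hf, mul_assoc, ← mul_pow]
    exact this
  have hsq := tendsto_zero_of_perturbed_decrease
    (a := fun k => f (Y (k + 2))) (b := fun k => (α⁻¹ - L) / 4 * ‖Y (k + 2 + 1) - Y (k + 2)‖ ^ 2)
    (s := fun k => α⁻¹ ^ 2 / (α⁻¹ - L) * (1 + α * L) ^ 2 * e (k + 2) ^ 2)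
    (fun k => by positivity) (fun k => by positivity)
    (((summable_nat_add_iff 2).2 hesum).mul_left _) (fun k => hxstar _)
    (fun k => by simpa only [add_right_comm] using hdec (k + 2) (by omega))
  have hΔ : Tendsto (fun k => ‖Y (k + 2 + 1) - Y (k + 2)‖) atTop (nhds 0) := by
    have h1 := (hsq.const_mul ((α⁻¹ - L) / 4)⁻¹).sqrt
    have hc : (α⁻¹ - L) / 4 ≠ 0 := by positivity
    simpa only [inv_mul_cancel_left₀ hc, mul_zero, Real.sqrt_zero,
      Real.sqrt_sq (norm_nonneg _)] using h1
  rw [← tendsto_add_atTop_iff_nat 2]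
  have hlim := (((tendsto_add_atTop_iff_nat 3).2 hetend).add hΔ).add
    ((tendsto_add_atTop_iff_nat 2).2 hetend)
  rw [add_zero, add_zero] at hlim
  refine squeeze_zero (fun k => norm_nonneg _) (fun k => ?_) hlim
  have h1 := hxbarY (k + 3) (by omega)
  have h2 := hxbarY (k + 2) (by omega)
  rw [norm_sub_rev] at h2
  calc ‖xbar (k + 3) - xbar (k + 2)‖
      = ‖(xbar (k + 3) - Y (k + 3)) + (Y (k + 3) - Y (k + 2)) + (Y (k + 2) - xbar (k + 2))‖ := by
        congr 1
        abel
    _ ≤ _ := norm_add₃_le.trans (add_le_add (add_le_add h1 le_rfl) h2)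
end
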